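/- arXiv:2006.12440 — 2 statements merged into one kernel-verified Lean document; each statement's English description precedes it below -/
import Mathlib

section
/- Let P = ⊗_{j=1}^n A_j ∈ 𝒫ₙ \ {I^{⊗n}}, U = R(P), and let P_r = ⊗_{j=1}^n B_j and P_s = ⊗_{j=1}^n C_j be n-qubit Pauli matrices (A_j, B_j, C_j ∈ {I, X, Y, Z}). Then Tr(P_r U P_s U†) = ¼(2+√2)·∏_{j=1}^n Tr(B_j C_j) + (i√2/4)·∏_{j=1}^n Tr(B_j C_j A_j) − (i√2/4)·∏_{j=1}^n Tr(B_j A_j C_j) + ¼(2−√2)·∏_{j=1}^n Tr(B_j A_j C_j A_j). -/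
open Matrix Complex

/-- The four single-qubit Pauli matrices I, X, Y, Z. -/
noncomputable def pauli : Fin 4 → Matrix (Fin 2) (Fin 2) ℂ :=
  ![1, !![0, 1; 1, 0], !![0, -Complex.I; Complex.I, 0], !![1, 0; 0, -1]]

/-- The n-qubit Pauli matrix A₁ ⊗ ⋯ ⊗ Aₙ (Kronecker product realized entrywise
on the index type `Fin n → Fin 2`). -/
noncomputable def nPauli {n : ℕ} (A : Fin n → Fin 4) :
    Matrix (Fin n → Fin 2) (Fin n → Fin 2) ℂ :=
  fun x y => ∏ j, pauli (A j) (x j) (y j)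

/-- R(P) = ½(1+e^{iπ/4})·I + ½(1−e^{iπ/4})·P. -/
noncomputable def RP {n : ℕ} (A : Fin n → Fin 4) :
    Matrix (Fin n → Fin 2) (Fin n → Fin 2) ℂ :=
  ((1 + Complex.exp (Complex.I * Real.pi / 4)) / 2) • 1 +
    ((1 - Complex.exp (Complex.I * Real.pi / 4)) / 2) • nPauli A

/-- The channel representation: Û_{rs} = (1/2ⁿ)·Tr(P_r U P_s U†). -/
noncomputable def chanRep {n : ℕ} (U : Matrix (Fin n → Fin 2) (Fin n → Fin 2) ℂ) :
    Matrix (Fin n → Fin 4) (Fin n → Fin 4) ℂ :=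
  fun r s => (1 / 2 ^ n : ℂ) * (nPauli r * U * nPauli s * Uᴴ).trace

/-- The Kronecker product of a finite family of square matrices. -/
def piKronecker {n : ℕ} {m R : Type*} [CommSemiring R] (M : Fin n → Matrix m m R) :
    Matrix (Fin n → m) (Fin n → m) R :=
  fun x y => ∏ j, M j (x j) (y j)

theorem piKronecker_mul {n : ℕ} {m R : Type*} [Fintype m] [CommSemiring R]
    (M N : Fin n → Matrix m m R) :
    piKronecker M * piKronecker N = piKronecker fun j => M j * N j := by
  classical
  ext x y
  simp only [Matrix.mul_apply, piKronecker, ← Finset.prod_mul_distrib]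
  exact (Fintype.prod_sum fun j k => M j (x j) k * N j k (y j)).symm

theorem trace_piKronecker {n : ℕ} {m R : Type*} [Fintype m] [CommSemiring R]
    (M : Fin n → Matrix m m R) : (piKronecker M).trace = ∏ j, (M j).trace := by
  classical
  simp only [Matrix.trace, Matrix.diag_apply, piKronecker]
  exact (Fintype.prod_sum fun j k => M j k k).symm

theorem conjTranspose_piKronecker {n : ℕ} {m R : Type*} [CommSemiring R] [StarRing R]
    (M : Fin n → Matrix m m R) : (piKronecker M)ᴴ = piKronecker fun j => (M j)ᴴ := by
  ext x y
  simp [piKronecker, Matrix.conjTranspose_apply, star_prod]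

theorem nPauli_eq_piKronecker {n : ℕ} (A : Fin n → Fin 4) :
    nPauli A = piKronecker fun j => pauli (A j) := rfl

theorem conjTranspose_pauli (k : Fin 4) : (pauli k)ᴴ = pauli k := by
  ext i j
  fin_cases k <;> fin_cases i <;> fin_cases j <;> simp [pauli]

theorem conjTranspose_nPauli {n : ℕ} (A : Fin n → Fin 4) : (nPauli A)ᴴ = nPauli A := by
  simp only [nPauli_eq_piKronecker, conjTranspose_piKronecker, conjTranspose_pauli]

theorem trace_mul_add_smul_mul_add_smul {m R : Type*} [Fintype m] [DecidableEq m] [CommRing R]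
    (B C P : Matrix m m R) (a b c d : R) :
    (B * (a • 1 + b • P) * C * (c • 1 + d • P)).trace =
      a * c * (B * C).trace + a * d * (B * C * P).trace + b * c * (B * P * C).trace +
        b * d * (B * P * C * P).trace := by
  simp only [mul_add, add_mul, Matrix.mul_smul, Matrix.smul_mul, mul_one, Matrix.trace_add,
    Matrix.trace_smul, smul_eq_mul]
  ring

theorem exp_I_mul_pi_div_four :
    Complex.exp (Complex.I * Real.pi / 4) = Real.sqrt 2 / 2 + Real.sqrt 2 / 2 * Complex.I := by
  rw [show Complex.I * Real.pi / 4 = ((Real.pi / 4 : ℝ) : ℂ) * Complex.I by push_cast; ring,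
    Complex.exp_mul_I, ← Complex.ofReal_cos, ← Complex.ofReal_sin, Real.cos_pi_div_four,
    Real.sin_pi_div_four]
  push_cast
  ring

theorem conjTranspose_RP {n : ℕ} (A : Fin n → Fin 4) :
    (RP A)ᴴ = ((1 + (Real.sqrt 2 / 2 - Real.sqrt 2 / 2 * Complex.I)) / 2 : ℂ) • 1 +
      ((1 - (Real.sqrt 2 / 2 - Real.sqrt 2 / 2 * Complex.I)) / 2 : ℂ) • nPauli A := by
  simp only [RP, exp_I_mul_pi_div_four, Matrix.conjTranspose_add, Matrix.conjTranspose_smul,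
    Matrix.conjTranspose_one, conjTranspose_nPauli]
  congr 2 <;> simp [sub_eq_add_neg]

/-- trace formula for Tr(P_r U P_s U†) as a combination of products
of single-qubit traces. -/
theorem trace_PrU_PsU_dagger {n : ℕ} (A B C : Fin n → Fin 4) (hA : A ≠ 0) :
    (nPauli B * RP A * nPauli C * (RP A)ᴴ).trace =
      ((2 + Real.sqrt 2) / 4 : ℂ) * ∏ j, (pauli (B j) * pauli (C j)).trace +
        (Complex.I * Real.sqrt 2 / 4) * ∏ j, (pauli (B j) * pauli (C j) * pauli (A j)).trace -
        (Complex.I * Real.sqrt 2 / 4) * ∏ j, (pauli (B j) * pauli (A j) * pauli (C j)).trace +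
        ((2 - Real.sqrt 2) / 4 : ℂ) *
          ∏ j, (pauli (B j) * pauli (A j) * pauli (C j) * pauli (A j)).trace := by
  have hs : (Real.sqrt 2 : ℂ) ^ 2 = 2 := by
    exact_mod_cast congrArg ((↑) : ℝ → ℂ) (Real.sq_sqrt (zero_le_two (α := ℝ)))
  have hI := Complex.I_sq
  rw [conjTranspose_RP, RP, exp_I_mul_pi_div_four, trace_mul_add_smul_mul_add_smul]
  simp only [nPauli_eq_piKronecker, piKronecker_mul, trace_piKronecker]
  grind
end

section
/- Let P ∈ 𝒫ₙ \ {I^{⊗n}} and let Û denote the channel representation map U ↦ Û. Then the channel representation of R(P)† (equivalently of R(P)⁻¹) equals the transpose of the channel representation of R(P); in particular, the matrix obtained from the channel representation of R(P) by transposition is its inverse: Û(R(P)) · Û(R(P))ᵀ = I. -/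
open Matrix Complex

/-- The tensor product of a family of matrices, realized entrywise on functions. -/
def tensorFamily {ι m R : Type*} [Fintype ι] [CommSemiring R] (M : ι → Matrix m m R) :
    Matrix (ι → m) (ι → m) R :=
  fun x y => ∏ j, M j (x j) (y j)

section tensorFamily

variable {ι m R : Type*} [Fintype ι] [CommSemiring R]

theorem tensorFamily_mul [DecidableEq ι] [Fintype m] (M N : ι → Matrix m m R) :
    tensorFamily M * tensorFamily N = tensorFamily fun j => M j * N j := by
  ext x z
  simp only [tensorFamily, Matrix.mul_apply, ← Finset.prod_mul_distrib, Finset.prod_univ_sum,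
    Fintype.piFinset_univ]

theorem trace_tensorFamily [DecidableEq ι] [Fintype m] (M : ι → Matrix m m R) :
    (tensorFamily M).trace = ∏ j, (M j).trace := by
  simp only [tensorFamily, Matrix.trace, Matrix.diag_apply, Finset.prod_univ_sum,
    Fintype.piFinset_univ]

theorem tensorFamily_one [DecidableEq m] :
    tensorFamily (fun _ : ι => (1 : Matrix m m R)) = 1 := by
  ext x y
  simp only [tensorFamily, Matrix.one_apply, Finset.prod_ite_zero, Finset.prod_const_one,
    Finset.mem_univ, true_imp_iff, funext_iff]

end tensorFamily

theorem pauli_conjTranspose (a : Fin 4) : (pauli a)ᴴ = pauli a := by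
  ext i j
  fin_cases a <;> fin_cases i <;> fin_cases j <;> simp [pauli]

theorem pauli_mul_self (a : Fin 4) : pauli a * pauli a = 1 := by
  ext i j
  fin_cases a <;> fin_cases i <;> fin_cases j <;> simp [pauli, Matrix.mul_apply]

theorem trace_pauli_mul (a b : Fin 4) :
    (pauli a * pauli b).trace = if a = b then 2 else 0 := by
  fin_cases a <;> fin_cases b <;> simp [pauli, Matrix.trace_fin_two, one_add_one_eq_two]

theorem sum_pauli_mul_pauli (a b c d : Fin 2) :
    ∑ s, pauli s a b * pauli s c d = if a = d ∧ b = c then 2 else 0 := by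
  fin_cases a <;> fin_cases b <;> fin_cases c <;> fin_cases d <;>
    simp [pauli, Fin.sum_univ_four, one_add_one_eq_two]

section nPauli

variable {n : ℕ}

theorem nPauli_eq_tensorFamily (A : Fin n → Fin 4) :
    nPauli A = tensorFamily fun j => pauli (A j) := rfl

theorem nPauli_conjTranspose (A : Fin n → Fin 4) : (nPauli A)ᴴ = nPauli A := by
  ext x y
  simp only [nPauli, Matrix.conjTranspose_apply, star_prod]
  exact Finset.prod_congr rfl fun j _ => by
    rw [← Matrix.conjTranspose_apply, pauli_conjTranspose]

theorem nPauli_mul_self (A : Fin n → Fin 4) : nPauli A * nPauli A = 1 := by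
  simp only [nPauli_eq_tensorFamily, tensorFamily_mul, pauli_mul_self, tensorFamily_one]

theorem trace_nPauli_mul (A B : Fin n → Fin 4) :
    (nPauli A * nPauli B).trace = if A = B then 2 ^ n else 0 := by
  simp only [nPauli_eq_tensorFamily, tensorFamily_mul, trace_tensorFamily, trace_pauli_mul,
    Finset.prod_ite_zero, Finset.prod_const, Finset.card_univ, Fintype.card_fin,
    Finset.mem_univ, true_imp_iff, funext_iff]

theorem sum_nPauli_mul_nPauli (a b c d : Fin n → Fin 2) :
    ∑ s, nPauli s a b * nPauli s c d = if a = d ∧ b = c then 2 ^ n else 0 := by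
  have h : ∏ j, ∑ s, pauli s (a j) (b j) * pauli s (c j) (d j)
      = ∑ s, nPauli s a b * nPauli s c d := by
    simp only [nPauli, ← Finset.prod_mul_distrib, Finset.prod_univ_sum, Fintype.piFinset_univ]
  simp only [← h, sum_pauli_mul_pauli, Finset.prod_ite_zero, Finset.prod_const, Finset.card_univ,
    Fintype.card_fin, Finset.mem_univ, true_imp_iff, funext_iff, forall_and]

/-- The completeness relation for the Pauli basis with respect to the trace form. -/
theorem sum_trace_mul_nPauli (M N : Matrix (Fin n → Fin 2) (Fin n → Fin 2) ℂ) :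
    ∑ s, (M * nPauli s).trace * (N * nPauli s).trace = 2 ^ n * (M * N).trace := by
  calc ∑ s, (M * nPauli s).trace * (N * nPauli s).trace
      = ∑ s, ∑ x, ∑ z, ∑ y, ∑ w, M x y * N z w * (nPauli s y x * nPauli s w z) := by
        simp only [Matrix.trace, Matrix.diag_apply, Matrix.mul_apply, Finset.sum_mul_sum,
          mul_mul_mul_comm]
    _ = ∑ x, ∑ z, ∑ y, ∑ w, M x y * N z w * ∑ s, nPauli s y x * nPauli s w z := by
        rw [Finset.sum_comm]
        refine Finset.sum_congr rfl fun x _ => ?_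
        rw [Finset.sum_comm]
        refine Finset.sum_congr rfl fun z _ => ?_
        rw [Finset.sum_comm]
        refine Finset.sum_congr rfl fun y _ => ?_
        rw [Finset.sum_comm]
        exact Finset.sum_congr rfl fun w _ => (Finset.mul_sum ..).symm
    _ = ∑ x, ∑ z, M x z * N z x * 2 ^ n := by
        simp only [sum_nPauli_mul_nPauli, ite_and, mul_ite, mul_zero, Finset.sum_ite_eq,
          Finset.sum_ite_eq', Finset.sum_ite_irrel, Finset.sum_const_zero, Finset.mem_univ,
          if_true]
    _ = 2 ^ n * (M * N).trace := by
        simp only [Matrix.trace, Matrix.diag_apply, Matrix.mul_apply, ← Finset.sum_mul]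
        exact mul_comm _ _

theorem RP_mul_conjTranspose (A : Fin n → Fin 4) : RP A * (RP A)ᴴ = 1 := by
  have he : Complex.exp (Complex.I * Real.pi / 4) *
      star (Complex.exp (Complex.I * Real.pi / 4)) = 1 := by
    rw [Complex.star_def, ← Complex.exp_conj, ← Complex.exp_add]
    simp [neg_div, map_ofNat]
  unfold RP
  generalize Complex.exp (Complex.I * Real.pi / 4) = e at he ⊢
  simp only [Matrix.conjTranspose_add, Matrix.conjTranspose_smul, Matrix.conjTranspose_one,
    nPauli_conjTranspose, add_mul, mul_add, smul_mul_smul_comm, one_mul, mul_one, nPauli_mul_self,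
    star_div₀, star_add, star_sub, star_one, star_ofNat]
  have h₁ : (1 + e) / 2 * ((1 + star e) / 2) + (1 - e) / 2 * ((1 - star e) / 2) = 1 := by
    linear_combination he / 2
  have h₂ : (1 - e) / 2 * ((1 + star e) / 2) + (1 + e) / 2 * ((1 - star e) / 2) = 0 := by
    linear_combination -he / 2
  calc _ = ((1 + e) / 2 * ((1 + star e) / 2) + (1 - e) / 2 * ((1 - star e) / 2)) •
          (1 : Matrix (Fin n → Fin 2) (Fin n → Fin 2) ℂ) +
        ((1 - e) / 2 * ((1 + star e) / 2) + (1 + e) / 2 * ((1 - star e) / 2)) • nPauli A := by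
        module
    _ = 1 := by rw [h₁, h₂, one_smul, zero_smul, add_zero]

theorem chanRep_conjTranspose (U : Matrix (Fin n → Fin 2) (Fin n → Fin 2) ℂ) :
    chanRep Uᴴ = (chanRep U)ᵀ := by
  ext r s
  simp only [chanRep, Matrix.transpose_apply, Matrix.conjTranspose_conjTranspose]
  rw [Matrix.mul_assoc, Matrix.trace_mul_comm, Matrix.mul_assoc (nPauli s * U)]

theorem chanRep_mul_transpose {U : Matrix (Fin n → Fin 2) (Fin n → Fin 2) ℂ}
    (hU : U * Uᴴ = 1) : chanRep U * (chanRep U)ᵀ = 1 := by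
  have key (r s : Fin n → Fin 4) :
      (nPauli r * U * nPauli s * Uᴴ).trace = (Uᴴ * nPauli r * U * nPauli s).trace := by
    rw [Matrix.trace_mul_comm]
    simp only [Matrix.mul_assoc]
  have cancel (r t : Fin n → Fin 4) :
      (Uᴴ * nPauli r * U * (Uᴴ * nPauli t * U)).trace = (nPauli r * nPauli t).trace := by
    have h : Uᴴ * nPauli r * U * (Uᴴ * nPauli t * U)
        = Uᴴ * (nPauli r * (U * Uᴴ) * nPauli t * U) := by
      simp only [Matrix.mul_assoc]
    rw [h, Matrix.trace_mul_comm, hU, Matrix.mul_one, Matrix.mul_assoc, hU, Matrix.mul_one]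
  ext r t
  simp only [Matrix.mul_apply, Matrix.transpose_apply, chanRep, key,
    mul_mul_mul_comm (1 / 2 ^ n : ℂ), ← Finset.mul_sum]
  rw [sum_trace_mul_nPauli, cancel, trace_nPauli_mul, Matrix.one_apply]
  split_ifs <;> simp [field]

end nPauli

/-- the channel representation of R(P)† equals the transpose of the
channel representation of R(P), and this transpose is its inverse. -/
theorem chanRep_adjoint_transpose {n : ℕ} (A : Fin n → Fin 4) (hA : A ≠ 0) :
    chanRep ((RP A)ᴴ) = (chanRep (RP A))ᵀ ∧
      chanRep (RP A) * (chanRep (RP A))ᵀ = 1 := by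
  exact ⟨chanRep_conjTranspose _, chanRep_mul_transpose (RP_mul_conjTranspose A)⟩
end
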